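/- arXiv:2309.14754 — 5 statements merged into one kernel-verified Lean document; each statement's English description precedes it below -/
import Mathlib

section
/- Let u : ℝ² → ℝ be smooth on a neighborhood of (0,0) and f : ℝ → ℝ smooth on a neighborhood of 0. Let k ≥ 1 and l ≥ 2 be integers and suppose: (a) ∂^i_{x₁}∂^j_{x₂} u(0,0) = 0 for all i + j < k; (b) f^(s)(0) = 0 for all 0 ≤ s ≤ l−1; (c) u(t, f(t)) = 0 for all t in a neighborhood of 0. Then ∂^m_{x₁} u(0,0) = 0 for every integer 0 ≤ m ≤ k + l − 2. -/
open Real Filter Topology Set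

noncomputable section

/-- The iterated partial derivative `∂^i_{x₁} ∂^j_{x₂} u (0,0)`. -/
def pd (u : ℝ × ℝ → ℝ) (i j : ℕ) : ℝ :=
  iteratedDeriv i (fun a => iteratedDeriv j (fun b => u (a, b)) 0) 0

open Asymptotics

theorem ContDiffAt.deriv_of_top {g : ℝ → ℝ} {x : ℝ} (hg : ContDiffAt ℝ (⊤ : ℕ∞) g x) :
    ContDiffAt ℝ (⊤ : ℕ∞) (deriv g) x :=
  (hg.fderiv_right (m := (⊤ : ℕ∞)) (by simp)).clm_apply contDiffAt_const

theorem ContDiffAt.eventually_differentiableAt {E : Type*} [NormedAddCommGroup E]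
    [NormedSpace ℝ E] {g : E → ℝ} {x : E} (hg : ContDiffAt ℝ (⊤ : ℕ∞) g x) :
    ∀ᶠ y in 𝓝 x, DifferentiableAt ℝ g y :=
  ((hg.of_le (m := 1) (by exact_mod_cast le_top)).eventually (by simp)).mono
    fun _ hy => hy.differentiableAt (by simp)

/-- A smooth function whose derivatives of order less than `n` vanish at `0` is `O(tⁿ)`. -/
theorem isBigO_pow_of_iteratedDeriv_eq_zero (n : ℕ) {g : ℝ → ℝ}
    (hg : ContDiffAt ℝ (⊤ : ℕ∞) g 0) (h : ∀ s < n, iteratedDeriv s g 0 = 0) :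
    g =O[𝓝 0] fun t => t ^ n := by
  induction n generalizing g with
  | zero => simpa using hg.continuousAt.isBigO_one ℝ
  | succ n ih =>
    have hd := ih hg.deriv_of_top fun s hs => by
      rw [← iteratedDeriv_succ']
      exact h _ (by omega)
    obtain ⟨C, hC, hCb⟩ := hd.exists_pos
    obtain ⟨r, hr, hball⟩ :=
      Metric.eventually_nhds_iff_ball.1 (hCb.bound.and hg.eventually_differentiableAt)
    refine IsBigO.of_bound C ?_
    filter_upwards [Metric.ball_mem_nhds (0 : ℝ) hr] with t ht
    have hsub : Metric.closedBall (0 : ℝ) |t| ⊆ Metric.ball 0 r := by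
      apply Metric.closedBall_subset_ball
      simpa using ht
    have key := Convex.norm_image_sub_le_of_norm_deriv_le (f := g) (C := C * |t| ^ n)
      (fun y hy => (hball y (hsub hy)).2)
      (fun y hy => by
        refine (hball y (hsub hy)).1.trans ?_
        have : |y| ≤ |t| := by simpa using hy
        rw [norm_pow, Real.norm_eq_abs]
        gcongr)
      (convex_closedBall (0 : ℝ) |t|) (x := 0) (y := t) (by simp) (by simp)
    have h0 : g 0 = 0 := by simpa using h 0 (by omega)
    rw [h0, sub_zero, sub_zero] at key
    rw [norm_pow, pow_succ, ← mul_assoc]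
    exact key

/-- If a smooth function is `O(tⁿ)` at `0`, its derivatives of order less than `n` vanish there. -/
theorem iteratedDeriv_eq_zero_of_isBigO_pow {n : ℕ} {g : ℝ → ℝ}
    (hg : ContDiffAt ℝ (⊤ : ℕ∞) g 0) (h : g =O[𝓝 0] fun t => t ^ n) :
    ∀ m < n, iteratedDeriv m g 0 = 0 := by
  intro m
  induction m using Nat.strong_induction_on with
  | _ m ih =>
    intro hm
    by_contra hne
    set c : ℝ := iteratedDeriv m g 0 / (m.factorial : ℝ) with hc
    have hfac : (m.factorial : ℝ) ≠ 0 := by exact_mod_cast m.factorial_ne_zero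
    have hc0 : c ≠ 0 := div_ne_zero hne hfac
    have hp : ContDiffAt ℝ (⊤ : ℕ∞) (fun t : ℝ => c * t ^ m) 0 :=
      contDiffAt_const.mul (contDiffAt_id.pow m)
    have hO : (fun t => g t - c * t ^ m) =O[𝓝 0] fun t => t ^ (m + 1) := by
      refine isBigO_pow_of_iteratedDeriv_eq_zero (m + 1) (hg.sub hp) fun s hs => ?_
      have hle : ((s : ℕ) : WithTop ℕ∞) ≤ ((⊤ : ℕ∞) : WithTop ℕ∞) := by
        exact_mod_cast le_top
      rw [iteratedDeriv_fun_sub (hg.of_le hle) (hp.of_le hle), iteratedDeriv_const_mul_field,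
        iteratedDeriv_pow]
      rcases Nat.lt_succ_iff_lt_or_eq.1 hs with hlt | rfl
      · have : m - s ≠ 0 := by omega
        simp [ih s hlt (by omega), this]
      · simp [Nat.descFactorial_self, hc, hfac]
    have hlit : (fun t : ℝ => t ^ m) =o[𝓝 0] fun t : ℝ => t ^ m := by
      have h1 := hO.trans_isLittleO (isLittleO_pow_pow (𝕜 := ℝ) (Nat.lt_succ_self m))
      have h2 := h.trans_isLittleO (isLittleO_pow_pow (𝕜 := ℝ) hm)
      have h3 := h2.sub h1
      simp only [sub_sub_cancel] at h3
      exact (isLittleO_const_mul_left_iff hc0).1 h3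
    have hfreq : ∃ᶠ t : ℝ in 𝓝 0, t ^ m ≠ 0 := by
      have : ∃ᶠ t : ℝ in 𝓝[≠] 0, t ^ m ≠ 0 :=
        (eventually_mem_nhdsWithin.mono fun t (ht : t ∈ ({0}ᶜ : Set ℝ)) =>
          pow_ne_zero m ht).frequently
      exact this.filter_mono nhdsWithin_le_nhds
    exact isLittleO_irrefl hfreq hlit

/-- The partial derivative in the second variable. -/
def derivSnd (v : ℝ × ℝ → ℝ) (p : ℝ × ℝ) : ℝ :=
  deriv (fun b => v (p.1, b)) p.2

theorem pd_derivSnd (v : ℝ × ℝ → ℝ) (i j : ℕ) : pd (derivSnd v) i j = pd v i (j + 1) := by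
  simp only [pd, iteratedDeriv_succ']
  rfl

theorem DifferentiableAt.hasDerivAt_snd {v : ℝ × ℝ → ℝ} {p : ℝ × ℝ}
    (h : DifferentiableAt ℝ v p) :
    HasDerivAt (fun b => v (p.1, b)) (fderiv ℝ v p (0, 1)) p.2 :=
  h.hasFDerivAt.comp_hasDerivAt (f := fun b => (p.1, b)) p.2
    ((hasDerivAt_const p.2 p.1).prodMk (hasDerivAt_id p.2))

theorem ContDiffAt.derivSnd {v : ℝ × ℝ → ℝ} {p : ℝ × ℝ}
    (hv : ContDiffAt ℝ (⊤ : ℕ∞) v p) : ContDiffAt ℝ (⊤ : ℕ∞) (derivSnd v) p := by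
  have h : ContDiffAt ℝ (⊤ : ℕ∞) (fun q => fderiv ℝ v q (0, 1)) p :=
    (hv.fderiv_right (m := (⊤ : ℕ∞)) (by simp)).clm_apply contDiffAt_const
  refine h.congr_of_eventuallyEq ?_
  filter_upwards [hv.eventually_differentiableAt] with q hq
  exact hq.hasDerivAt_snd.deriv

theorem ContDiffAt.restrict_fst {v : ℝ × ℝ → ℝ} (hv : ContDiffAt ℝ (⊤ : ℕ∞) v 0) :
    ContDiffAt ℝ (⊤ : ℕ∞) (fun t => v (t, 0)) 0 :=
  ContDiffAt.comp (g := v) (f := fun t : ℝ => (t, (0 : ℝ))) 0 hv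
    (contDiffAt_id.prodMk contDiffAt_const)

/-- A bound on the second partial derivative controls the increments in the second variable. -/
theorem isBigO_sub_of_derivSnd {v : ℝ × ℝ → ℝ} {n : ℕ}
    (hv : ContDiffAt ℝ (⊤ : ℕ∞) v 0)
    (h : derivSnd v =O[𝓝 0] fun p => ‖p‖ ^ n) :
    (fun p => v p - v (p.1, 0)) =O[𝓝 0] fun p => ‖p‖ ^ n * p.2 := by
  obtain ⟨C, hC, hCb⟩ := h.exists_pos
  obtain ⟨r, hr, hball⟩ :=
    Metric.eventually_nhds_iff_ball.1 (hCb.bound.and hv.eventually_differentiableAt)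
  refine IsBigO.of_bound C ?_
  filter_upwards [Metric.ball_mem_nhds (0 : ℝ × ℝ) hr] with p hp
  have hnorm : ∀ y ∈ Metric.closedBall (0 : ℝ) |p.2|, ‖(p.1, y)‖ ≤ ‖p‖ := by
    intro y hy
    have : |y| ≤ |p.2| := by simpa using hy
    exact max_le_max le_rfl this
  have hmem : ∀ y ∈ Metric.closedBall (0 : ℝ) |p.2|, (p.1, y) ∈ Metric.ball (0 : ℝ × ℝ) r :=
    fun y hy => mem_ball_zero_iff.2 ((hnorm y hy).trans_lt (mem_ball_zero_iff.1 hp))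
  have key := Convex.norm_image_sub_le_of_norm_deriv_le (f := fun y => v (p.1, y))
    (C := C * ‖p‖ ^ n)
    (fun y hy => (hball _ (hmem y hy)).2.hasDerivAt_snd.differentiableAt)
    (fun y hy => by
      refine (hball _ (hmem y hy)).1.trans ?_
      rw [norm_pow, norm_norm]
      gcongr
      exact hnorm y hy)
    (convex_closedBall (0 : ℝ) |p.2|) (x := 0) (y := p.2) (by simp) (by simp)
  rw [norm_mul, norm_pow, norm_norm, ← mul_assoc]
  simpa using key

/-- If all partial derivatives of order less than `n` of a smooth function vanish at the origin,
the function is `O(‖p‖ⁿ)` there. -/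
theorem isBigO_norm_pow_of_pd_eq_zero (n : ℕ) {v : ℝ × ℝ → ℝ}
    (hv : ContDiffAt ℝ (⊤ : ℕ∞) v 0) (h : ∀ i j : ℕ, i + j < n → pd v i j = 0) :
    v =O[𝓝 0] fun p => ‖p‖ ^ n := by
  induction n generalizing v with
  | zero => simpa using hv.continuousAt.isBigO_one ℝ
  | succ n ih =>
    have hd := isBigO_sub_of_derivSnd hv <| ih hv.derivSnd fun i j hij => by
      rw [pd_derivSnd]
      exact h _ _ (by omega)
    have h1 : (fun p => v p - v (p.1, 0)) =O[𝓝 0] fun p => ‖p‖ ^ (n + 1) := by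
      refine hd.trans (IsBigO.of_bound 1 (Eventually.of_forall fun p => ?_))
      rw [norm_mul, norm_pow, norm_pow, norm_norm, one_mul, pow_succ]
      gcongr
      exact norm_snd_le p
    have h2 : (fun p : ℝ × ℝ => v (p.1, 0)) =O[𝓝 0] fun p => ‖p‖ ^ (n + 1) := by
      have ht := isBigO_pow_of_iteratedDeriv_eq_zero (n + 1) hv.restrict_fst fun s hs => by
        simpa [pd] using h s 0 (by omega)
      refine (ht.comp_tendsto (continuous_fst.tendsto (0 : ℝ × ℝ))).trans
        (IsBigO.of_bound 1 (Eventually.of_forall fun p => ?_))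
      simp only [Function.comp_apply, norm_pow, norm_norm, one_mul]
      gcongr
      exact norm_fst_le p
    simpa using h1.add h2

/-- If `u` vanishes to order `k` at the origin and the curve `(t, f(t))`,
tangent to the `x₁`-axis to the order `l - 1`, lies in the zero set of `u`, then all pure
`x₁`-derivatives of `u` at the origin of order at most `k + l - 2` vanish. -/
theorem pure_x1_derivatives_vanish
    (u : ℝ × ℝ → ℝ) (hu : ∃ s ∈ 𝓝 ((0, 0) : ℝ × ℝ), ContDiffOn ℝ (⊤ : ℕ∞) u s)
    (f : ℝ → ℝ) (hf : ∃ s ∈ 𝓝 (0 : ℝ), ContDiffOn ℝ (⊤ : ℕ∞) f s)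
    (k l : ℕ) (hk : 1 ≤ k) (hl : 2 ≤ l)
    (ha : ∀ i j : ℕ, i + j < k → pd u i j = 0)
    (hb : ∀ s : ℕ, s ≤ l - 1 → iteratedDeriv s f 0 = 0)
    (hc : ∀ᶠ t in 𝓝 (0 : ℝ), u (t, f t) = 0) :
    ∀ m : ℕ, m ≤ k + l - 2 → pd u m 0 = 0 := by
  have hu0 : ContDiffAt ℝ (⊤ : ℕ∞) u 0 := by
    obtain ⟨s, hs, hus⟩ := hu
    exact hus.contDiffAt hs
  have hf0 : ContDiffAt ℝ (⊤ : ℕ∞) f 0 := by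
    obtain ⟨s, hs, hfs⟩ := hf
    exact hfs.contDiffAt hs
  obtain ⟨k, rfl⟩ : ∃ k', k = k' + 1 := ⟨k - 1, by omega⟩
  have hfO : f =O[𝓝 0] fun t => t ^ l :=
    isBigO_pow_of_iteratedDeriv_eq_zero l hf0 fun s hs => hb s (by omega)
  have hfO1 : f =O[𝓝 0] fun t => t := by
    simpa using hfO.trans (isLittleO_pow_pow (𝕜 := ℝ) (m := 1) (by omega)).isBigO
  have hcurve : Tendsto (fun t => (t, f t)) (𝓝 0) (𝓝 (0 : ℝ × ℝ)) := by
    have hf00 : f 0 = 0 := by simpa using hb 0 (by omega)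
    have hcont : ContinuousAt (fun t => (t, f t)) 0 := continuousAt_id.prodMk hf0.continuousAt
    simpa [ContinuousAt, hf00, ← Prod.zero_eq_mk] using hcont
  have hdiff := isBigO_sub_of_derivSnd (n := k) hu0 <|
    isBigO_norm_pow_of_pd_eq_zero k hu0.derivSnd fun i j hij => by
      rw [pd_derivSnd]
      exact ha _ _ (by omega)
  have hnorm : (fun t => ‖(t, f t)‖) =O[𝓝 0] fun t => t :=
    ((isBigO_refl (fun t : ℝ => t) (𝓝 0)).prod_left hfO1).norm_left
  have haxis : (fun t => u (t, 0)) =O[𝓝 0] fun t => t ^ (k + l) := by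
    have h1 := (hdiff.comp_tendsto hcurve).trans ((hnorm.pow k).mul hfO)
    simp only [← pow_add] at h1
    refine h1.neg_left.congr' ?_ EventuallyEq.rfl
    filter_upwards [hc] with t ht
    simp [ht]
  intro m hm
  simpa [pd] using iteratedDeriv_eq_zero_of_isBigO_pow hu0.restrict_fst haxis m (by omega)
end
end

section
/- Let u : ℝ² → ℝ be smooth on a neighborhood of (0,0) and f : ℝ → ℝ smooth on a neighborhood of 0. Suppose f^(s)(0) = 0 for every integer s ≥ 0 and u(t, f(t)) = 0 for all t in a neighborhood of 0. Then ∂^m_{x₁} u(0,0) = 0 for every integer m ≥ 0. -/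
open Real Filter Topology Set

noncomputable section

/-- Taylor's theorem with Peano remainder, at a point of `C^n` regularity. -/
theorem ContDiffAt.sub_taylor_isLittleO {g : ℝ → ℝ} {x₀ : ℝ} {n : ℕ} (hg : ContDiffAt ℝ n g x₀) :
    (fun x ↦ g x - ∑ k ∈ Finset.range (n + 1),
      ((k.factorial : ℝ)⁻¹ * (x - x₀) ^ k) • iteratedDeriv k g x₀) =o[𝓝 x₀]
      fun x ↦ (x - x₀) ^ n := by
  obtain ⟨v, hv, hgv⟩ := hg.contDiffOn le_rfl (by simp)
  obtain ⟨ε, hε, hball⟩ := Metric.mem_nhds_iff.mp hv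
  have hx₀ := Metric.mem_ball_self (x := x₀) hε
  have h := taylor_isLittleO (convex_ball x₀ ε) hx₀ (hgv.mono hball)
  rw [Metric.isOpen_ball.nhdsWithin_eq hx₀] at h
  simpa only [taylor_within_apply, iteratedDerivWithin_of_isOpen Metric.isOpen_ball hx₀] using h

/-- A function all of whose derivatives up to order `n` vanish at a point is `o((x - x₀)^n)`. -/
theorem ContDiffAt.isLittleO_pow_of_iteratedDeriv_eq_zero {g : ℝ → ℝ} {x₀ : ℝ} {n : ℕ}
    (hg : ContDiffAt ℝ n g x₀) (h0 : ∀ k ≤ n, iteratedDeriv k g x₀ = 0) :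
    g =o[𝓝 x₀] fun x ↦ (x - x₀) ^ n := by
  refine hg.sub_taylor_isLittleO.congr_left fun x ↦ ?_
  rw [Finset.sum_eq_zero, sub_zero]
  intro k hk
  rw [h0 k (Finset.mem_range_succ_iff.mp hk), smul_zero]

/-- A smooth function that is `o((x - x₀)^n)` for every `n` has vanishing derivatives at `x₀`. -/
theorem ContDiffAt.iteratedDeriv_eq_zero_of_isLittleO_pow {g : ℝ → ℝ} {x₀ : ℝ}
    (hg : ContDiffAt ℝ (⊤ : ℕ∞) g x₀) (h : ∀ n : ℕ, g =o[𝓝 x₀] fun x ↦ (x - x₀) ^ n) (m : ℕ) :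
    iteratedDeriv m g x₀ = 0 := by
  induction m using Nat.strong_induction_on with
  | _ m ih =>
    have ht := (hg.of_le (m := m) (by exact_mod_cast le_top)).sub_taylor_isLittleO
    have hd := (h m).sub ht
    have hm : (fun x ↦ ((m.factorial : ℝ)⁻¹ * iteratedDeriv m g x₀) * (x - x₀) ^ m)
        =o[𝓝 x₀] fun x ↦ (x - x₀) ^ m := by
      refine hd.congr_left fun x ↦ ?_
      rw [sub_sub_cancel, Finset.sum_range_succ, Finset.sum_eq_zero, smul_eq_mul]
      · ring
      · intro k hk
        rw [ih k (Finset.mem_range.mp hk), smul_zero]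
    by_contra hne
    have hc : (m.factorial : ℝ)⁻¹ * iteratedDeriv m g x₀ ≠ 0 :=
      mul_ne_zero (inv_ne_zero (by exact_mod_cast m.factorial_ne_zero)) hne
    rw [Asymptotics.isLittleO_const_mul_left_iff hc] at hm
    have hfreq : ∃ᶠ x in 𝓝 x₀, (x - x₀) ^ m ≠ 0 := by
      have : ∃ᶠ x in 𝓝[≠] x₀, (x - x₀) ^ m ≠ 0 :=
        Eventually.frequently <| eventually_mem_nhdsWithin.mono fun x hx ↦
          pow_ne_zero m (sub_ne_zero.mpr hx)
      exact this.filter_mono nhdsWithin_le_nhds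
    exact Asymptotics.isLittleO_irrefl hfreq hm

/-- If the curve `(t, f(t))`, tangent to the `x₁`-axis to infinite order,
lies in the zero set of `u`, then all pure `x₁`-derivatives of `u` at the origin vanish. -/
theorem pure_x1_derivatives_vanish_infinite_order
    (u : ℝ × ℝ → ℝ) (hu : ∃ s ∈ 𝓝 ((0, 0) : ℝ × ℝ), ContDiffOn ℝ (⊤ : ℕ∞) u s)
    (f : ℝ → ℝ) (hf : ∃ s ∈ 𝓝 (0 : ℝ), ContDiffOn ℝ (⊤ : ℕ∞) f s)
    (hb : ∀ s : ℕ, iteratedDeriv s f 0 = 0)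
    (hc : ∀ᶠ t in 𝓝 (0 : ℝ), u (t, f t) = 0) :
    ∀ m : ℕ, pd u m 0 = 0 := by
  intro m
  obtain ⟨s, hs, hus⟩ := hu
  obtain ⟨v, hv, hfv⟩ := hf
  have hu0 : ContDiffAt ℝ (⊤ : ℕ∞) u (0, 0) := hus.contDiffAt hs
  have hf0 : ContDiffAt ℝ (⊤ : ℕ∞) f 0 := hfv.contDiffAt hv
  have hfz : f 0 = 0 := by simpa using hb 0
  have hg : ContDiffAt ℝ (⊤ : ℕ∞) (fun a ↦ u (a, 0)) 0 :=
    ContDiffAt.comp (0 : ℝ) (f := fun a : ℝ ↦ (a, (0 : ℝ))) hu0 (by fun_prop)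
  obtain ⟨K, w, hw, hK⟩ :=
    (hu0.of_le (m := 1) (by exact_mod_cast le_top)).exists_lipschitzOnWith
  have haxis : ∀ᶠ t in 𝓝 (0 : ℝ), (t, (0 : ℝ)) ∈ w :=
    (Continuous.prodMk_left (0 : ℝ)).continuousAt.eventually hw
  have hcurve : ∀ᶠ t in 𝓝 (0 : ℝ), (t, f t) ∈ w := by
    have : ContinuousAt (fun t ↦ (t, f t)) 0 := continuousAt_id.prodMk hf0.continuousAt
    exact this.eventually (by simpa [hfz] using hw)
  have hO : (fun a ↦ u (a, 0)) =O[𝓝 0] f := by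
    refine Asymptotics.IsBigO.of_bound K ?_
    filter_upwards [haxis, hcurve, hc] with t h₁ h₂ h₃
    simpa [h₃, dist_eq_norm, Prod.norm_def] using hK.dist_le_mul _ h₁ _ h₂
  simp only [pd, iteratedDeriv_zero]
  refine hg.iteratedDeriv_eq_zero_of_isLittleO_pow (fun n ↦ hO.trans_isLittleO ?_) m
  exact (hf0.of_le (m := n) (by exact_mod_cast le_top)).isLittleO_pow_of_iteratedDeriv_eq_zero
    fun k _ ↦ hb k
end
end

section
/- Let k ≥ 1 be an integer, let u : ℝ² → ℝ be smooth on a neighborhood of (0,0) with ∂^i_{x₁}∂^j_{x₂} u(0,0) = 0 for all i + j < k, and suppose there are β ∈ ℝ and α ∈ [0, π) such that sup_{t∈[0,2π]} | r^{−k} u(r cos t, r sin t) − β sin(α − kt) | → 0 as r → 0⁺. Then ∂^k_{x₁} u(0,0) = k! · β · sin α and ∂^{k−1}_{x₁}∂_{x₂} u(0,0) = − k! · β · cos α. -/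
open Real Filter Topology Set

noncomputable section

open scoped ContDiff

section Smooth

variable {E F : Type*} [NormedAddCommGroup E] [NormedSpace ℝ E]
  [NormedAddCommGroup F] [NormedSpace ℝ F]

/-- A function smooth near a point agrees near that point with a globally smooth function. -/
theorem ContDiffOn.exists_contDiff_eventuallyEq [HasContDiffBump E] {f : E → F} {s : Set E} {x : E}
    (hs : s ∈ 𝓝 x) (hf : ContDiffOn ℝ ∞ f s) : ∃ g, ContDiff ℝ ∞ g ∧ g =ᶠ[𝓝 x] f := by
  obtain ⟨d, hd, hds⟩ := Metric.mem_nhds_iff.1 hs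
  let c : ContDiffBump x := ⟨d / 4, d / 2, by positivity, by linarith⟩
  refine ⟨fun y => c y • f y, ?_, ?_⟩
  · refine contDiff_iff_contDiffAt.2 fun y => ?_
    by_cases hy : y ∈ Metric.ball x d
    · exact c.contDiffAt.smul
        ((hf.mono hds).contDiffAt (Metric.isOpen_ball.mem_nhds hy))
    · have hy' : y ∉ tsupport c := by
        rw [c.tsupport_eq]
        intro h
        apply hy
        rw [Metric.mem_closedBall] at h
        rw [Metric.mem_ball]
        have : c.rOut = d / 2 := rfl
        linarith
      have h0 : (fun y => c y • f y) =ᶠ[𝓝 y] fun _ => 0 := by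
        filter_upwards [notMem_tsupport_iff_eventuallyEq.1 hy'] with z hz
        simp [hz]
      exact contDiffAt_const.congr_of_eventuallyEq h0
  · filter_upwards [c.eventuallyEq_one] with y hy
    simp [hy]

theorem ContDiff.iteratedDeriv_comp_smul_const {f : E → F} (hf : ContDiff ℝ ∞ f) (n : ℕ) (v : E) :
    iteratedDeriv n (fun r : ℝ => f (r • v)) 0 = iteratedFDeriv ℝ n f 0 fun _ => v := by
  have h := (ContinuousLinearMap.toSpanSingleton ℝ v).iteratedFDeriv_comp_right hf 0
    (i := n) (by exact_mod_cast le_top)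
  have h' : (fun r : ℝ => f (r • v)) = f ∘ ContinuousLinearMap.toSpanSingleton ℝ v := by
    ext r; simp
  rw [iteratedDeriv_eq_iteratedFDeriv, h', h]
  simp

theorem ContDiff.fderiv_apply_const {f : E → F} (hf : ContDiff ℝ ∞ f) (v : E) :
    ContDiff ℝ ∞ fun x => fderiv ℝ f x v :=
  (hf.fderiv_right (m := ∞) (by simp)).clm_apply contDiff_const

theorem ContDiff.iteratedFDeriv_succ_apply {f : E → F} (hf : ContDiff ℝ ∞ f) {n : ℕ} (x : E)
    (m : Fin (n + 1) → E) :
    iteratedFDeriv ℝ (n + 1) f x m =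
      iteratedFDeriv ℝ n (fun y => fderiv ℝ f y (m (Fin.last n))) x (Fin.init m) := by
  rw [iteratedFDeriv_succ_apply_right, iteratedFDeriv_clm_apply_const_apply
    (hf.fderiv_right (m := ∞) (by simp)) (by exact_mod_cast le_top)]

/-- In an iterated derivative along `v` with one slot replaced by `w`, the position of the slot is
immaterial. -/
theorem ContDiff.iteratedFDeriv_update_const {f : E → F} (hf : ContDiff ℝ ∞ f) {n : ℕ} (x v w : E)
    (i : Fin (n + 1)) :
    iteratedFDeriv ℝ (n + 1) f x (Function.update (fun _ => v) i w) =
      iteratedFDeriv ℝ n (fun y => fderiv ℝ f y w) x fun _ => v := by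
  induction n generalizing f with
  | zero =>
    rw [hf.iteratedFDeriv_succ_apply, Fin.fin_one_eq_zero i]
    simp
  | succ n ih =>
    rw [hf.iteratedFDeriv_succ_apply]
    induction i using Fin.lastCases with
    | last => simp [Fin.init_def]
    | cast j =>
      rw [Fin.init_update_castSucc, Function.update_of_ne (Fin.castSucc_lt_last j).ne']
      have hcomm : (fun y => fderiv ℝ (fun z => fderiv ℝ f z v) y w) =
          fun y => fderiv ℝ (fun z => fderiv ℝ f z w) y v := by
        ext y
        have hd : DifferentiableAt ℝ (fderiv ℝ f) y :=
          (hf.fderiv_right (m := ∞) (by simp)).differentiable (by simp) y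
        rw [fderiv_clm_apply hd (by fun_prop), fderiv_clm_apply hd (by fun_prop)]
        simpa using (hf.contDiffAt.isSymmSndFDerivAt
          (by simpa using WithTop.coe_le_coe.2 (le_top : (2 : ℕ∞) ≤ ⊤))) w v
      have := ih (hf.fderiv_apply_const v) j
      rw [hcomm] at this
      rw [(hf.fderiv_apply_const w).iteratedFDeriv_succ_apply]
      exact this

end Smooth

/-- A smooth function with `g r / r ^ k → L` as `r → 0⁺` has `k`-th derivative `k! L` at `0`. -/
theorem ContDiff.iteratedDeriv_eq_of_tendsto_div_pow {g : ℝ → ℝ} (hg : ContDiff ℝ ∞ g) {k : ℕ}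
    {L : ℝ} (h : Tendsto (fun r => g r / r ^ k) (𝓝[>] 0) (𝓝 L)) :
    iteratedDeriv k g 0 = k.factorial * L := by
  have taylor (n : ℕ) (hn : ∀ m < n, iteratedDeriv m g 0 = 0) :
      Tendsto (fun r => g r / r ^ n) (𝓝[>] 0) (𝓝 (iteratedDeriv n g 0 / n.factorial)) := by
    have ht := Real.taylor_tendsto (f := g) (n := n) convex_univ (mem_univ (0 : ℝ))
      (hg.of_le (by exact_mod_cast le_top)).contDiffOn
    rw [nhdsWithin_univ] at ht
    have ht' := (ht.mono_left (nhdsWithin_le_nhds (s := Ioi 0))).add_const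
      (iteratedDeriv n g 0 / n.factorial)
    rw [zero_add] at ht'
    refine ht'.congr' ?_
    filter_upwards [self_mem_nhdsWithin] with r (hr : 0 < r)
    have hsum : taylorWithinEval g n univ 0 r = r ^ n * (iteratedDeriv n g 0 / n.factorial) := by
      rw [taylor_within_apply, Finset.sum_range_succ, Finset.sum_eq_zero]
      · simp only [iteratedDerivWithin_univ, smul_eq_mul]
        ring
      · intro m hm
        rw [iteratedDerivWithin_univ, hn m (Finset.mem_range.1 hm), smul_zero]
    rw [hsum, sub_zero, sub_div, mul_div_cancel_left₀ _ (pow_ne_zero n hr.ne'), sub_add_cancel]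
  have lower (n : ℕ) (hn : n < k) : iteratedDeriv n g 0 = 0 := by
    induction n using Nat.strong_induction_on with
    | _ n ih =>
      have h1 := taylor n fun m hm => ih m hm (hm.trans hn)
      have hpow : Tendsto (fun r : ℝ => r ^ (k - n)) (𝓝[>] 0) (𝓝 0) := by
        have : Tendsto (fun r : ℝ => r ^ (k - n)) (𝓝 0) (𝓝 (0 ^ (k - n))) :=
          (continuous_pow (k - n)).tendsto 0
        rw [zero_pow (Nat.sub_ne_zero_of_lt hn)] at this
        exact this.mono_left nhdsWithin_le_nhds
      have h2 := h.mul hpow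
      rw [mul_zero] at h2
      have h3 := tendsto_nhds_unique h1 (h2.congr' ?_)
      · simpa [Nat.factorial_ne_zero] using h3
      · filter_upwards [self_mem_nhdsWithin] with r (hr : 0 < r)
        have hk : r ^ k = r ^ n * r ^ (k - n) := by rw [← pow_add, Nat.add_sub_cancel' hn.le]
        rw [hk]
        field_simp
  have := tendsto_nhds_unique (taylor k lower) h
  rw [← this, mul_div_cancel₀ _ (by exact_mod_cast k.factorial_ne_zero)]

theorem pd_congr {u w : ℝ × ℝ → ℝ} (h : w =ᶠ[𝓝 (0, 0)] u) (i j : ℕ) : pd u i j = pd w i j := by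
  refine Filter.EventuallyEq.iteratedDeriv_eq i ?_
  have ht : Tendsto (fun a : ℝ => (a, (0 : ℝ))) (𝓝 0) (𝓝 (0, 0)) :=
    (by fun_prop : Continuous fun a : ℝ => (a, (0 : ℝ))).tendsto 0
  filter_upwards [ht.eventually h.eventually_nhds] with a ha
  refine Filter.EventuallyEq.iteratedDeriv_eq j ?_
  have ht' : Tendsto (fun b : ℝ => (a, b)) (𝓝 0) (𝓝 (a, 0)) :=
    (by fun_prop : Continuous fun b : ℝ => (a, b)).tendsto 0
  filter_upwards [ht'.eventually ha] with b hb using hb.symm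

theorem pd_zero_right {w : ℝ × ℝ → ℝ} (hw : ContDiff ℝ ∞ w) (k : ℕ) :
    pd w k 0 = iteratedFDeriv ℝ k w 0 fun _ => (1, 0) := by
  rw [← hw.iteratedDeriv_comp_smul_const]
  simp [pd]

theorem pd_one_right {w : ℝ × ℝ → ℝ} (hw : ContDiff ℝ ∞ w) (k : ℕ) :
    pd w k 1 = iteratedFDeriv ℝ k (fun y => fderiv ℝ w y (0, 1)) 0 fun _ => (1, 0) := by
  rw [← (hw.fderiv_apply_const _).iteratedDeriv_comp_smul_const, pd]
  congr 1
  ext a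
  have h1 : HasDerivAt (fun b : ℝ => (a, b)) (0, 1) 0 :=
    (hasDerivAt_const _ _).prodMk (hasDerivAt_id _)
  have h2 := ((hw.differentiable (by simp)) (a, 0)).hasFDerivAt.comp_hasDerivAt 0 h1
  simpa [iteratedDeriv_one, Function.comp_def] using h2.deriv

/-- The blow-up hypothesis gives convergence along each ray. -/
theorem tendsto_div_pow_of_tendsto_iSup {u w : ℝ × ℝ → ℝ} (hw : Continuous w)
    (h : w =ᶠ[𝓝 (0, 0)] u) {k : ℕ} {φ : ℝ → ℝ} (hφ : Continuous φ)
    (hsup : Tendsto (fun r : ℝ => ⨆ t : Icc (0 : ℝ) (2 * π),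
      |u (r * Real.cos t, r * Real.sin t) / r ^ k - φ t|) (𝓝[>] 0) (𝓝 0))
    (t : Icc (0 : ℝ) (2 * π)) :
    Tendsto (fun r : ℝ => w (r * Real.cos t, r * Real.sin t) / r ^ k) (𝓝[>] 0) (𝓝 (φ t)) := by
  obtain ⟨d, hd, hball⟩ := Metric.eventually_nhds_iff_ball.1 h
  rw [← tendsto_sub_nhds_zero_iff]
  refine squeeze_zero_norm' ?_ hsup
  filter_upwards [Ioo_mem_nhdsGT hd] with r hr
  have heq (s : Icc (0 : ℝ) (2 * π)) :
      u (r * Real.cos s, r * Real.sin s) = w (r * Real.cos s, r * Real.sin s) := by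
    refine (hball _ ?_).symm
    rw [Metric.mem_ball, Prod.dist_eq, max_lt_iff]
    simp only [Real.dist_eq, sub_zero, abs_mul, abs_of_pos hr.1]
    exact ⟨(mul_le_of_le_one_right hr.1.le (Real.abs_cos_le_one _)).trans_lt hr.2,
      (mul_le_of_le_one_right hr.1.le (Real.abs_sin_le_one _)).trans_lt hr.2⟩
  simp_rw [heq]
  have hc : Continuous fun s : Icc (0 : ℝ) (2 * π) =>
      |w (r * Real.cos s, r * Real.sin s) / r ^ k - φ s| := by fun_prop
  exact le_ciSup (isCompact_range hc).bddAbove t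

/-- If the `k`-th order blow-up of `u` at the origin converges uniformly on
the circle to `t ↦ β sin(α − kt)`, then `∂^k_{x₁} u(0,0) = k! β sin α` and
`∂^{k−1}_{x₁}∂_{x₂} u(0,0) = − k! β cos α`. -/
theorem blowup_determines_top_coefficients
    (k : ℕ) (hk : 1 ≤ k)
    (u : ℝ × ℝ → ℝ) (hu : ∃ s ∈ 𝓝 ((0, 0) : ℝ × ℝ), ContDiffOn ℝ (⊤ : ℕ∞) u s)
    (ha : ∀ i j : ℕ, i + j < k → pd u i j = 0)
    (β α : ℝ) (hα : α ∈ Ico 0 π)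
    (hblowup : Tendsto
      (fun r : ℝ => ⨆ t : Icc (0 : ℝ) (2 * π),
        |u (r * Real.cos t, r * Real.sin t) / r ^ k - β * Real.sin (α - k * (t : ℝ))|)
      (𝓝[>] 0) (𝓝 0)) :
    pd u k 0 = (k.factorial : ℝ) * β * Real.sin α ∧
      pd u (k - 1) 1 = -((k.factorial : ℝ) * β * Real.cos α) := by
  obtain ⟨s, hs, hus⟩ := hu
  obtain ⟨w, hw, hwu⟩ := hus.exists_contDiff_eventuallyEq hs
  have hray (t : ℝ) (ht : t ∈ Icc 0 (2 * π)) :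
      iteratedFDeriv ℝ k w 0 (fun _ => (Real.cos t, Real.sin t)) =
        k.factorial * (β * Real.sin (α - k * t)) := by
    rw [← hw.iteratedDeriv_comp_smul_const]
    refine ContDiff.iteratedDeriv_eq_of_tendsto_div_pow
      (hw.comp (contDiff_id.smul contDiff_const)) ?_
    simpa using tendsto_div_pow_of_tendsto_iSup hw.continuous hwu
      (φ := fun t => β * Real.sin (α - k * t)) (by fun_prop) hblowup ⟨t, ht⟩
  have hpi : (0 : ℝ) < 2 * π := by positivity
  refine ⟨?_, ?_⟩
  · rw [pd_congr hwu, pd_zero_right hw]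
    simpa [mul_assoc] using hray 0 ⟨le_rfl, hpi.le⟩
  · rw [pd_congr hwu, pd_one_right hw]
    obtain ⟨n, rfl⟩ : ∃ n, k = n + 1 := ⟨k - 1, by omega⟩
    rw [Nat.add_sub_cancel]
    have hv : HasDerivAt (fun (t : ℝ) (_ : Fin (n + 1)) => (Real.cos t, Real.sin t))
        (fun _ => ((0 : ℝ), (1 : ℝ))) 0 :=
      hasDerivAt_pi.2 fun _ => by
        simpa using (Real.hasDerivAt_cos 0).prodMk (Real.hasDerivAt_sin 0)
    have hl := ((iteratedFDeriv ℝ (n + 1) w 0).hasFDerivAt _).comp_hasDerivAt 0 hv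
    have hr : HasDerivAt (fun t : ℝ => ((n + 1).factorial : ℝ) *
        (β * Real.sin (α - (n + 1 : ℕ) * t)))
        ((n + 1).factorial * (β * (Real.cos (α - (n + 1 : ℕ) * 0) * -((n + 1 : ℕ) * 1)))) 0 :=
      ((((hasDerivAt_id' (0 : ℝ)).const_mul _).const_sub α).sin.const_mul β).const_mul _
    have hsub : Icc 0 (2 * π) ∈ 𝓝[≥] (0 : ℝ) := Icc_mem_nhdsGE hpi
    have huniq := (uniqueDiffOn_Ici (0 : ℝ) 0 self_mem_Ici).eq_deriv _ hl.hasDerivWithinAt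
      (hr.hasDerivWithinAt.congr_of_eventuallyEq
        (by filter_upwards [hsub] with t ht using hray t ht) (hray 0 ⟨le_rfl, hpi.le⟩))
    rw [ContinuousMultilinearMap.linearDeriv_apply] at huniq
    simp only [Real.cos_zero, Real.sin_zero, hw.iteratedFDeriv_update_const, Finset.sum_const,
      Finset.card_univ, Fintype.card_fin, nsmul_eq_mul, mul_zero, sub_zero, mul_one] at huniq
    refine mul_left_cancel₀ (Nat.cast_ne_zero (R := ℝ).2 n.succ_ne_zero) (huniq.trans ?_)
    ring
end
end

section
/- Let u : ℝ² → ℝ be real-analytic on a neighborhood of (0,0) and let f : ℝ → ℝ be smooth on a neighborhood of 0 with f^(s)(0) = 0 for every integer s ≥ 0. If u(t, f(t)) = 0 for all t in a neighborhood of 0, then u(t, 0) = 0 for all t in a neighborhood of 0; that is, a nodal line of u tangent to infinite order to the x₁-axis forces u to vanish identically on a segment of the x₁-axis around the origin. -/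
open Real Filter Topology Set

noncomputable section

/-- A smooth function all of whose derivatives vanish at the origin is `o(t ^ n)` for every `n`. -/
theorem isLittleO_pow_of_iteratedDeriv_eq_zero {f : ℝ → ℝ} {s : Set ℝ} (hs : s ∈ 𝓝 (0 : ℝ))
    (hf : ContDiffOn ℝ (⊤ : ℕ∞) f s) (hflat : ∀ k : ℕ, iteratedDeriv k f 0 = 0) (n : ℕ) :
    f =o[𝓝 0] fun t => t ^ n := by
  obtain ⟨ε, hε, hball⟩ := Metric.mem_nhds_iff.1 hs
  have h0 : (0 : ℝ) ∈ Metric.ball (0 : ℝ) ε := Metric.mem_ball_self hε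
  have hfn : ContDiffOn ℝ n f (Metric.ball 0 ε) :=
    (hf.mono hball).of_le (by exact_mod_cast le_top)
  have h := taylor_isLittleO (convex_ball (0 : ℝ) ε) h0 hfn
  rw [Metric.isOpen_ball.nhdsWithin_eq h0] at h
  simpa [taylor_within_apply, iteratedDerivWithin_of_isOpen Metric.isOpen_ball h0, hflat] using h

/-- An analytic function that is `o(t ^ n)` at the origin for every `n` vanishes near the origin. -/
theorem AnalyticAt.eventually_eq_zero_of_isLittleO_pow {g : ℝ → ℝ} (hg : AnalyticAt ℝ g 0)
    (h : ∀ n : ℕ, g =o[𝓝 0] fun t => t ^ n) : ∀ᶠ t in 𝓝 (0 : ℝ), g t = 0 := by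
  by_contra hne
  obtain ⟨n, k, hk, hk0, hgk⟩ := hg.exists_eventuallyEq_pow_smul_nonzero_iff.2 hne
  have hpos : 0 < ‖k 0‖ / 2 := half_pos (norm_pos_iff.2 hk0)
  have hlarge : ∀ᶠ t in 𝓝 (0 : ℝ), ‖k 0‖ / 2 < ‖k t‖ :=
    hk.continuousAt.norm.eventually_const_lt (half_lt_self (norm_pos_iff.2 hk0))
  have hev := (hgk.and (hlarge.and ((h n).def hpos))).filter_mono
    (nhdsWithin_le_nhds (s := {(0 : ℝ)}ᶜ))
  obtain ⟨t, ⟨hgt, hlt, hle⟩, ht⟩ := (hev.and self_mem_nhdsWithin).exists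
  have htn : 0 < ‖t ^ n‖ := norm_pos_iff.2 (pow_ne_zero n ht)
  rw [hgt, sub_zero, norm_smul, mul_comm] at hle
  exact absurd (le_of_mul_le_mul_right hle htn) hlt.not_ge

/-- A nodal line of a real-analytic function tangent to infinite order to
the `x₁`-axis forces the function to vanish identically on a segment of the `x₁`-axis around
the origin. -/
theorem analytic_vanishes_on_axis_of_infinite_order_tangency
    (u : ℝ × ℝ → ℝ) (hu : AnalyticAt ℝ u ((0, 0) : ℝ × ℝ))
    (f : ℝ → ℝ) (hf : ∃ s ∈ 𝓝 (0 : ℝ), ContDiffOn ℝ (⊤ : ℕ∞) f s)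
    (hflat : ∀ s : ℕ, iteratedDeriv s f 0 = 0)
    (hnodal : ∀ᶠ t in 𝓝 (0 : ℝ), u (t, f t) = 0) :
    ∀ᶠ t in 𝓝 (0 : ℝ), u (t, 0) = 0 := by
  obtain ⟨s, hs, hfs⟩ := hf
  have hfo := isLittleO_pow_of_iteratedDeriv_eq_zero hs hfs hflat
  have hf0 : f 0 = 0 := by simpa using hflat 0
  have hfc : ContinuousAt f 0 := hfs.continuousOn.continuousAt hs
  have haxis : AnalyticAt ℝ (fun t : ℝ => u (t, 0)) 0 :=
    hu.comp_of_eq (analyticAt_id.prod analyticAt_const) rfl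
  refine haxis.eventually_eq_zero_of_isLittleO_pow fun n => ?_
  obtain ⟨K, v, hv, hK⟩ := (hu.contDiffAt (n := 1)).exists_lipschitzOnWith
  have hgraph : Tendsto (fun t => (t, f t)) (𝓝 0) (𝓝 ((0, 0) : ℝ × ℝ)) := by
    simpa [ContinuousAt, hf0] using continuousAt_id.prodMk hfc
  have hline : Tendsto (fun t : ℝ => (t, (0 : ℝ))) (𝓝 0) (𝓝 (0, 0)) :=
    tendsto_id.prodMk_nhds tendsto_const_nhds
  refine Asymptotics.IsBigO.trans_isLittleO (.of_bound K ?_) (hfo n)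
  filter_upwards [hnodal, hgraph hv, hline hv] with t ht h1 h2
  simpa [ht, dist_eq_norm, Prod.norm_def] using hK.dist_le_mul _ h2 _ h1
end
end

section
/- Let H be a real Hilbert space with orthonormal Hilbert basis (g_i)_{i≥1}, let D ⊆ H be a dense subspace containing every g_i, and let q : D × D → ℝ be a symmetric bilinear form for which there is a nondecreasing sequence (ν_i)_{i≥1} of real numbers with q(g_i, g) = ν_i ⟨g_i, g⟩ for every i ≥ 1 and every g ∈ D. Let N, m ≥ 1 be integers, let F be an m-dimensional subspace of D, and let ξ_1^F ≤ … ≤ ξ_m^F be the eigenvalues of the restriction of q to F, i.e. ξ_i^F := min { max { q(w,w)/‖w‖² : w ∈ W, w ≠ 0 } : W an i-dimensional subspace of F }. Assume there exist constants γ, δ > 0 such that: (H1) δ < γ/√2; (H2) |ν_{N+i−1}| ≤ γ for all 1 ≤ i ≤ m, ν_{N+m} ≥ γ, and ν_{N−1} ≤ −γ if N ≥ 2; (H3) |q(φ, g)| ≤ δ ‖φ‖ ‖g‖ for all g ∈ D and all φ ∈ F. Then: (i) |ν_{N+i−1} − ξ_i^F| ≤ 4δ²/γ for all 1 ≤ i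 ≤ m; and (ii) ‖Π_N φ − φ‖ ≤ (√2 δ/γ) ‖φ‖ for all φ ∈ F, where Π_N : H → H is the orthogonal projection onto the closed span of {g_N, …, g_{N+m−1}}. -/
open Filter Topology Set RealInnerProductSpace

noncomputable section

/-- If `q φ` is bounded by `δ ‖φ‖` and `q` is diagonal in the orthonormal basis `b` with
eigenvalues `a`, then every finite partial sum of the `(a k ⟪b k, φ⟫)²` is at most `(δ ‖φ‖)²`. -/
lemma sum_sq_eigenvalue_mul_inner_le {ι H : Type*} [NormedAddCommGroup H] [InnerProductSpace ℝ H]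
    (b : HilbertBasis ι ℝ H) (D : Submodule ℝ H) (hbD : ∀ k, b k ∈ D) (q : D →ₗ[ℝ] D →ₗ[ℝ] ℝ)
    (a : ι → ℝ) {δ : ℝ} {φ : D}
    (heig : ∀ k, q φ ⟨b k, hbD k⟩ = a k * ⟪b k, (φ : H)⟫)
    (hφ : ∀ ψ : D, |q φ ψ| ≤ δ * ‖(φ : H)‖ * ‖(ψ : H)‖) (S : Finset ι) :
    ∑ k ∈ S, (a k * ⟪b k, (φ : H)⟫) ^ 2 ≤ (δ * ‖(φ : H)‖) ^ 2 := by
  set t := ∑ k ∈ S, (a k * ⟪b k, (φ : H)⟫) ^ 2 with ht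
  have ht0 : 0 ≤ t := Finset.sum_nonneg fun _ _ => sq_nonneg _
  let ψ : D := ∑ k ∈ S, (a k * ⟪b k, (φ : H)⟫) • (⟨b k, hbD k⟩ : D)
  have hq : q φ ψ = t := by
    simp only [ψ, map_sum, map_smul, heig, smul_eq_mul, ht, sq]
  have hψ : ‖(ψ : H)‖ ^ 2 = t := by
    rw [← real_inner_self_eq_norm_sq]
    simp only [ψ, Submodule.coe_sum, Submodule.coe_smul]
    rw [b.orthonormal.inner_sum]
    simp [ht, sq]
  have h := hφ ψ
  rw [hq, abs_of_nonneg ht0] at h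
  rcases ht0.eq_or_lt with h0 | h0
  · rw [← h0]; positivity
  · have h2 : t ^ 2 ≤ (δ * ‖(φ : H)‖) ^ 2 * t := by
      calc t ^ 2 ≤ (δ * ‖(φ : H)‖ * ‖(ψ : H)‖) ^ 2 := pow_le_pow_left₀ ht0 h 2
        _ = _ := by rw [mul_pow _ ‖(ψ : H)‖, hψ]
    nlinarith

/-- If `q φ` is bounded, then `q φ φ` is the sum of the series given by the eigenbasis. -/
lemma hasSum_eigenvalue_mul_inner_sq {ι H : Type*} [NormedAddCommGroup H] [InnerProductSpace ℝ H]
    (b : HilbertBasis ι ℝ H) (D : Submodule ℝ H) (hbD : ∀ k, b k ∈ D) (q : D →ₗ[ℝ] D →ₗ[ℝ] ℝ)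
    (a : ι → ℝ) {δ : ℝ} {φ : D}
    (heig : ∀ k, q φ ⟨b k, hbD k⟩ = a k * ⟪b k, (φ : H)⟫)
    (hφ : ∀ ψ : D, |q φ ψ| ≤ δ * ‖(φ : H)‖ * ‖(ψ : H)‖) :
    HasSum (fun k => a k * ⟪b k, (φ : H)⟫ ^ 2) (q φ φ) := by
  have hs : Tendsto (fun S : Finset ι => ∑ k ∈ S, ⟪b k, (φ : H)⟫ • b k) atTop (𝓝 (φ : H)) := by
    have h := b.hasSum_repr (φ : H)
    simp only [b.repr_apply_apply] at h
    exact h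
  have hlim : Tendsto (fun S : Finset ι =>
      δ * ‖(φ : H)‖ * ‖(∑ k ∈ S, ⟪b k, (φ : H)⟫ • b k) - (φ : H)‖) atTop (𝓝 0) := by
    simpa using (tendsto_iff_norm_sub_tendsto_zero.1 hs).const_mul (δ * ‖(φ : H)‖)
  change Tendsto _ _ _
  rw [tendsto_iff_norm_sub_tendsto_zero]
  refine squeeze_zero (fun _ => norm_nonneg _) (fun S => ?_) hlim
  have h := hφ ((∑ k ∈ S, ⟪b k, (φ : H)⟫ • (⟨b k, hbD k⟩ : D)) - φ)
  simp only [map_sub, map_sum, map_smul, heig, smul_eq_mul, Submodule.coe_sub, Submodule.coe_sum,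
    Submodule.coe_smul] at h
  rw [Real.norm_eq_abs]
  convert h using 4 with k
  ring

/-- If all eigenvalues outside `B` are at least `γ` in absolute value, then the components of `φ`
outside `B` are small. -/
lemma norm_sq_sub_sum_inner_sq_le {ι H : Type*} [NormedAddCommGroup H] [InnerProductSpace ℝ H]
    (b : HilbertBasis ι ℝ H) (D : Submodule ℝ H) (hbD : ∀ k, b k ∈ D) (q : D →ₗ[ℝ] D →ₗ[ℝ] ℝ)
    (a : ι → ℝ) {δ γ : ℝ} (hγ : 0 < γ) {φ : D}
    (heig : ∀ k, q φ ⟨b k, hbD k⟩ = a k * ⟪b k, (φ : H)⟫)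
    (hφ : ∀ ψ : D, |q φ ψ| ≤ δ * ‖(φ : H)‖ * ‖(ψ : H)‖) (B : Finset ι)
    (hB : ∀ k ∉ B, γ ≤ |a k|) :
    ‖(φ : H)‖ ^ 2 - ∑ k ∈ B, ⟪b k, (φ : H)⟫ ^ 2 ≤ (δ / γ) ^ 2 * ‖(φ : H)‖ ^ 2 := by
  classical
  have hs : Tendsto (fun S : Finset ι => ∑ k ∈ S, ⟪b k, (φ : H)⟫ ^ 2) atTop
      (𝓝 (‖(φ : H)‖ ^ 2)) := by
    have h := b.hasSum_inner_mul_inner (φ : H) (φ : H)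
    simp only [real_inner_self_eq_norm_sq, real_inner_comm (b _), ← sq] at h
    exact h
  refine le_of_tendsto (hs.sub_const _) ?_
  filter_upwards [eventually_ge_atTop B] with S hS
  rw [← Finset.sum_sdiff hS, add_sub_cancel_right]
  have h := sum_sq_eigenvalue_mul_inner_le b D hbD q a heig hφ (S \ B)
  have h1 : γ ^ 2 * ∑ k ∈ S \ B, ⟪b k, (φ : H)⟫ ^ 2
      ≤ ∑ k ∈ S \ B, (a k * ⟪b k, (φ : H)⟫) ^ 2 := by
    rw [Finset.mul_sum]
    refine Finset.sum_le_sum fun k hk => ?_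
    rw [mul_pow, ← sq_abs (a k)]
    have := hB k (Finset.mem_sdiff.1 hk).2
    gcongr
  rw [div_pow, div_mul_eq_mul_div, le_div_iff₀ (by positivity), ← mul_pow]
  linarith

/-- If all eigenvalues outside `B` are at least `γ` in absolute value, then the components of `φ`
outside `B` contribute little to `q φ φ`. -/
lemma abs_apply_self_sub_sum_le {ι H : Type*} [NormedAddCommGroup H] [InnerProductSpace ℝ H]
    (b : HilbertBasis ι ℝ H) (D : Submodule ℝ H) (hbD : ∀ k, b k ∈ D) (q : D →ₗ[ℝ] D →ₗ[ℝ] ℝ)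
    (a : ι → ℝ) {δ γ : ℝ} (hγ : 0 < γ) {φ : D}
    (heig : ∀ k, q φ ⟨b k, hbD k⟩ = a k * ⟪b k, (φ : H)⟫)
    (hφ : ∀ ψ : D, |q φ ψ| ≤ δ * ‖(φ : H)‖ * ‖(ψ : H)‖) (B : Finset ι)
    (hB : ∀ k ∉ B, γ ≤ |a k|) :
    |q φ φ - ∑ k ∈ B, a k * ⟪b k, (φ : H)⟫ ^ 2| ≤ δ ^ 2 / γ * ‖(φ : H)‖ ^ 2 := by
  classical
  have hs := hasSum_eigenvalue_mul_inner_sq b D hbD q a heig hφ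
  refine le_of_tendsto (Tendsto.sub_const hs _).abs ?_
  filter_upwards [eventually_ge_atTop B] with S hS
  rw [← Finset.sum_sdiff hS, add_sub_cancel_right]
  have h := sum_sq_eigenvalue_mul_inner_le b D hbD q a heig hφ (S \ B)
  have h1 : γ * |∑ k ∈ S \ B, a k * ⟪b k, (φ : H)⟫ ^ 2|
      ≤ ∑ k ∈ S \ B, (a k * ⟪b k, (φ : H)⟫) ^ 2 := by
    refine (mul_le_mul_of_nonneg_left (Finset.abs_sum_le_sum_abs _ _) hγ.le).trans ?_
    rw [Finset.mul_sum]
    refine Finset.sum_le_sum fun k hk => ?_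
    rw [abs_mul, abs_sq, ← mul_assoc, mul_pow, ← sq_abs (a k), sq |a k|]
    have := hB k (Finset.mem_sdiff.1 hk).2
    gcongr
  rw [div_mul_eq_mul_div, le_div_iff₀ hγ, ← mul_pow]
  linarith

/-- A subspace contains subspaces of every dimension up to its own. -/
lemma Submodule.exists_le_finrank_eq {K V : Type*} [DivisionRing K] [AddCommGroup V] [Module K V]
    (F : Submodule K V) {i : ℕ} (hi : i ≤ Module.finrank K F) :
    ∃ W ≤ F, Module.finrank K W = i := by
  obtain ⟨u, hu⟩ := exists_linearIndependent_of_le_finrank hi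
  refine ⟨Submodule.span K (Set.range (F.subtype ∘ u)), ?_, ?_⟩
  · rw [Submodule.span_le]
    rintro _ ⟨j, rfl⟩
    exact (u j).2
  · rw [finrank_span_eq_card (hu.map' F.subtype F.ker_subtype), Fintype.card_fin]

/-- The vectors of `F` killed by a linear map to `κ → K` contain a subspace of every dimension up
to `finrank F - card κ`. -/
lemma Submodule.exists_le_finrank_eq_apply_eq_zero {K V κ : Type*} [Field K] [AddCommGroup V]
    [Module K V] [Fintype κ] (F : Submodule K V) [FiniteDimensional K F] (f : V →ₗ[K] κ → K)
    {i : ℕ} (hi : Fintype.card κ + i ≤ Module.finrank K F) :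
    ∃ W ≤ F, Module.finrank K W = i ∧ ∀ w ∈ W, f w = 0 := by
  have h1 := (f.domRestrict F).finrank_range_add_finrank_ker
  have h2 : Module.finrank K (f.domRestrict F).range ≤ Fintype.card κ := by
    simpa using (f.domRestrict F).range.finrank_le
  obtain ⟨W, hW, hWi⟩ := ((f.domRestrict F).ker.map F.subtype).exists_le_finrank_eq (i := i)
    (by rw [Submodule.finrank_map_subtype_eq]; omega)
  refine ⟨W, hW.trans (Submodule.map_subtype_le _ _), hWi, fun w hw => ?_⟩
  obtain ⟨x, hx, rfl⟩ := hW hw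
  exact hx

/-- The vectors of `F` orthogonal to `n` given vectors contain a subspace of every dimension up to
`finrank F - n`. -/
lemma exists_submodule_finrank_eq_inner_eq_zero {ι H : Type*} [NormedAddCommGroup H]
    [InnerProductSpace ℝ H] (v : ι → H) {D : Submodule ℝ H} (F : Submodule ℝ D)
    [FiniteDimensional ℝ F] (T : Finset ι) {i : ℕ} (hi : T.card + i ≤ Module.finrank ℝ F) :
    ∃ W : Submodule ℝ D, W ≤ F ∧ Module.finrank ℝ W = i ∧
      ∀ w ∈ W, ∀ k ∈ T, ⟪v k, (w : H)⟫ = 0 := by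
  let f : D →ₗ[ℝ] T → ℝ := LinearMap.pi fun k => (innerSL ℝ (v k)).toLinearMap ∘ₗ D.subtype
  obtain ⟨W, hW, hWi, h⟩ := F.exists_le_finrank_eq_apply_eq_zero f
    (by rwa [Fintype.card_coe])
  exact ⟨W, hW, hWi, fun w hw k hk => congrFun (h w hw) ⟨k, hk⟩⟩

/-- A min-max value is within `ε` of `μ` if every `i`-dimensional subspace of `F` contains a
nonzero vector with Rayleigh quotient at least `μ - ε` and some `i`-dimensional subspace has all
its Rayleigh quotients at most `μ + ε`. -/
lemma abs_sub_minmax_le {H : Type*} [NormedAddCommGroup H] [InnerProductSpace ℝ H]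
    {D : Submodule ℝ H} (q : D →ₗ[ℝ] D →ₗ[ℝ] ℝ) (F : Submodule ℝ D) {i : ℕ} (hi : 1 ≤ i)
    {C μ ε : ℝ} (hC : ∀ w ∈ F, w ≠ 0 → q w w / ‖(w : H)‖ ^ 2 ≤ C)
    (hlow : ∀ W ≤ F, Module.finrank ℝ W = i →
      ∃ w ∈ W, w ≠ 0 ∧ μ - ε ≤ q w w / ‖(w : H)‖ ^ 2)
    (hupp : ∃ W ≤ F, Module.finrank ℝ W = i ∧
      ∀ w ∈ W, w ≠ 0 → q w w / ‖(w : H)‖ ^ 2 ≤ μ + ε) :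
    |μ - sInf { r : ℝ | ∃ W : Submodule ℝ D, W ≤ F ∧ Module.finrank ℝ W = i ∧
        r = sSup { s : ℝ | ∃ w ∈ W, w ≠ 0 ∧ s = q w w / ‖(w : H)‖ ^ 2 } }| ≤ ε := by
  set A : Set ℝ := { r : ℝ | ∃ W : Submodule ℝ D, W ≤ F ∧ Module.finrank ℝ W = i ∧
    r = sSup { s : ℝ | ∃ w ∈ W, w ≠ 0 ∧ s = q w w / ‖(w : H)‖ ^ 2 } }
  have hlb : ∀ r ∈ A, μ - ε ≤ r := by
    rintro r ⟨W, hW, hWi, rfl⟩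
    obtain ⟨w, hw, hw0, h⟩ := hlow W hW hWi
    refine h.trans (le_csSup ⟨C, ?_⟩ ⟨w, hw, hw0, rfl⟩)
    rintro s ⟨w, hw, hw0, rfl⟩
    exact hC w (hW hw) hw0
  obtain ⟨W, hW, hWi, h⟩ := hupp
  have hmem : sSup { s : ℝ | ∃ w ∈ W, w ≠ 0 ∧ s = q w w / ‖(w : H)‖ ^ 2 } ∈ A :=
    ⟨W, hW, hWi, rfl⟩
  rw [abs_sub_le_iff]
  constructor
  · have h1 := le_csInf ⟨_, hmem⟩ hlb
    linarith
  · have h1 := csInf_le ⟨μ - ε, hlb⟩ hmem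
    have h2 : sSup { s : ℝ | ∃ w ∈ W, w ≠ 0 ∧ s = q w w / ‖(w : H)‖ ^ 2 } ≤ μ + ε := by
      have : Nontrivial W := Module.nontrivial_of_finrank_pos (R := ℝ) (by omega)
      obtain ⟨w, hw⟩ := exists_ne (0 : W)
      refine csSup_le ⟨_, w, w.2, by simpa using hw, rfl⟩ ?_
      rintro s ⟨w, hw, hw0, rfl⟩
      exact h w hw hw0
    linarith

/-- Abstract eigenvalue-approximation lemma (Proposition 3.1 of
Abatangelo–Léna–Musolino): if a quadratic form `q` with discrete spectrum `ν` and orthonormal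
eigenbasis `g` is small on an `m`-dimensional subspace `F` in the sense of (H1)–(H3), then the
eigenvalues `ν_N, …, ν_{N+m−1}` are approximated by the eigenvalues of the restriction of `q`
to `F`, and `F` is close to the span of `g_N, …, g_{N+m−1}`. -/
theorem abstract_eigenvalue_approximation
    {H : Type*} [NormedAddCommGroup H] [InnerProductSpace ℝ H] [CompleteSpace H]
    (g : ℕ → H)
    (hON : Orthonormal ℝ (fun i : ℕ => g (i + 1)))
    (htotal : (Submodule.span ℝ (Set.range (fun i : ℕ => g (i + 1)))).topologicalClosure = ⊤)
    (D : Submodule ℝ H) (hdense : Dense (D : Set H))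
    (hgD : ∀ i : ℕ, 1 ≤ i → g i ∈ D)
    (q : D →ₗ[ℝ] D →ₗ[ℝ] ℝ)
    (hqsymm : ∀ φ ψ : D, q φ ψ = q ψ φ)
    (ν : ℕ → ℝ) (hνmono : ∀ i j : ℕ, 1 ≤ i → i ≤ j → ν i ≤ ν j)
    (heigen : ∀ i : ℕ, (hi : 1 ≤ i) → ∀ φ : D, q ⟨g i, hgD i hi⟩ φ = ν i * ⟪g i, (φ : H)⟫)
    (N m : ℕ) (hN : 1 ≤ N) (hm : 1 ≤ m)
    (F : Submodule ℝ D) (hF : Module.finrank ℝ F = m)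
    (ξ : ℕ → ℝ)
    (hξ : ∀ i : ℕ, 1 ≤ i → i ≤ m →
      ξ i = sInf { r : ℝ | ∃ W : Submodule ℝ D, W ≤ F ∧ Module.finrank ℝ W = i ∧
        r = sSup { s : ℝ | ∃ w ∈ W, w ≠ 0 ∧ s = q w w / ‖(w : H)‖ ^ 2 } })
    (γ δ : ℝ) (hγ : 0 < γ) (hδ : 0 < δ)
    (H1 : δ < γ / Real.sqrt 2)
    (H2a : ∀ i : ℕ, 1 ≤ i → i ≤ m → |ν (N + i - 1)| ≤ γ)
    (H2b : γ ≤ ν (N + m))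
    (H2c : 2 ≤ N → ν (N - 1) ≤ -γ)
    (H3 : ∀ φ ∈ F, ∀ ψ : D, |q φ ψ| ≤ δ * ‖(φ : H)‖ * ‖(ψ : H)‖) :
    (∀ i : ℕ, 1 ≤ i → i ≤ m → |ν (N + i - 1) - ξ i| ≤ 4 * δ ^ 2 / γ) ∧
    ∀ φ ∈ F, ∃ ψ ∈ Submodule.span ℝ {x : H | ∃ i < m, x = g (N + i)},
      ((φ : H) - ψ ∈ (Submodule.span ℝ {x : H | ∃ i < m, x = g (N + i)})ᗮ ∧
       ‖ψ - (φ : H)‖ ≤ Real.sqrt 2 * δ / γ * ‖(φ : H)‖) := by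
  obtain ⟨N, rfl⟩ := Nat.exists_eq_add_of_le' hN
  let b : HilbertBasis ℕ ℝ H := HilbertBasis.mk hON htotal.ge
  have hb : ∀ k, b k = g (k + 1) := fun k => by simp [b]
  have hbD : ∀ k, b k ∈ D := fun k => hb k ▸ hgD (k + 1) (by omega)
  let a : ℕ → ℝ := fun k => ν (k + 1)
  have ha : Monotone a := fun i j hij => hνmono _ _ (by omega) (by omega)
  have heig : ∀ (φ : D) k, q φ ⟨b k, hbD k⟩ = a k * ⟪b k, (φ : H)⟫ := fun φ k => by
    rw [hqsymm]
    simp only [hb]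
    exact heigen _ (by omega) _
  let B : Finset ℕ := Finset.Ico N (N + m)
  have hB : ∀ k ∉ B, γ ≤ |a k| := by
    intro k hk
    rw [Finset.mem_Ico, not_and_or, not_le, not_lt] at hk
    rcases hk with hk | hk
    · have h1 : a k ≤ a (N - 1) := ha (by omega)
      have h2 : a (N - 1) ≤ -γ := by
        have := H2c (by omega)
        simp only [a]
        rwa [Nat.sub_add_cancel (by omega)]
      rw [abs_of_nonpos (by linarith)]
      linarith
    · have h1 : a (N + m) ≤ a k := ha hk
      have h2 : γ ≤ a (N + m) := by
        rwa [add_right_comm] at H2b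
      exact (h2.trans h1).trans (le_abs_self _)
  have hF3 : ∀ φ ∈ F, ‖(φ : H)‖ ^ 2 - ∑ k ∈ B, ⟪b k, (φ : H)⟫ ^ 2
      ≤ (δ / γ) ^ 2 * ‖(φ : H)‖ ^ 2 := fun φ hφ =>
    norm_sq_sub_sum_inner_sq_le b D hbD q a hγ (heig φ) (H3 φ hφ) B hB
  refine ⟨fun i hi him => ?_, fun φ hφ => ?_⟩
  · obtain ⟨i, rfl⟩ := Nat.exists_eq_add_of_le' hi
    have : FiniteDimensional ℝ F := Module.finite_of_finrank_pos (by omega)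
    have hμ : |a (N + i)| ≤ γ := by
      have := H2a (i + 1) hi him
      rwa [show N + 1 + (i + 1) - 1 = N + i + 1 by omega] at this
    have hP : ∀ w : D, ∑ k ∈ B, ⟪b k, (w : H)⟫ ^ 2 ≤ ‖(w : H)‖ ^ 2 := fun w => by
      simpa using b.orthonormal.sum_inner_products_le (x := (w : H)) (s := B)
    have hrest : ∀ w ∈ F, |a (N + i) * ∑ k ∈ B, ⟪b k, (w : H)⟫ ^ 2 - a (N + i) * ‖(w : H)‖ ^ 2|
        ≤ δ ^ 2 / γ * ‖(w : H)‖ ^ 2 := fun w hw => by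
      rw [← mul_sub, abs_mul, abs_sub_comm, abs_of_nonneg (sub_nonneg.2 (hP w))]
      calc _ ≤ γ * ((δ / γ) ^ 2 * ‖(w : H)‖ ^ 2) :=
            mul_le_mul hμ (hF3 w hw) (sub_nonneg.2 (hP w)) hγ.le
        _ = _ := by field_simp
    have hq : ∀ w ∈ F, |q w w - ∑ k ∈ B, a k * ⟪b k, (w : H)⟫ ^ 2|
        ≤ δ ^ 2 / γ * ‖(w : H)‖ ^ 2 := fun w hw =>
      abs_apply_self_sub_sum_le b D hbD q a hγ (heig w) (H3 w hw) B hB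
    have hε : 2 * δ ^ 2 / γ ≤ 4 * δ ^ 2 / γ := by gcongr; norm_num
    have hε' : 2 * δ ^ 2 / γ = 2 * (δ ^ 2 / γ) := by ring
    have hnorm : ∀ w : D, w ≠ 0 → 0 < ‖(w : H)‖ ^ 2 := fun w hw => by
      have : (w : H) ≠ 0 := by simpa using hw
      positivity
    rw [hξ _ hi him, show N + 1 + (i + 1) - 1 = N + i + 1 by omega]
    refine (abs_sub_minmax_le q F hi (C := δ) (μ := a (N + i)) ?_ ?_ ?_).trans hε
    · intro w hw hw0
      rw [div_le_iff₀ (hnorm w hw0)]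
      linarith [(le_abs_self _).trans (H3 w hw w)]
    · intro W hW hWi
      have : FiniteDimensional ℝ W := Module.finite_of_finrank_pos (by omega)
      obtain ⟨W', hW', hW'1, h0⟩ := exists_submodule_finrank_eq_inner_eq_zero b W
        (Finset.Ico N (N + i)) (i := 1) (by simp [hWi])
      have : Nontrivial W' := Module.nontrivial_of_finrank_pos (R := ℝ) (by omega)
      obtain ⟨⟨w, hw⟩, hw0⟩ := exists_ne (0 : W')
      have hw0 : w ≠ 0 := by simpa using hw0
      refine ⟨w, hW' hw, hw0, ?_⟩
      rw [le_div_iff₀ (hnorm w hw0), hε', sub_mul]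
      have hsum : a (N + i) * ∑ k ∈ B, ⟪b k, (w : H)⟫ ^ 2
          ≤ ∑ k ∈ B, a k * ⟪b k, (w : H)⟫ ^ 2 := by
        rw [Finset.mul_sum]
        refine Finset.sum_le_sum fun k hk => ?_
        by_cases hki : k < N + i
        · simp [h0 w hw k (Finset.mem_Ico.2 ⟨(Finset.mem_Ico.1 hk).1, hki⟩)]
        · exact mul_le_mul_of_nonneg_right (ha (by omega)) (sq_nonneg _)
      have h1 := abs_le.1 (hq w (hW (hW' hw)))
      have h2 := abs_le.1 (hrest w (hW (hW' hw)))
      linarith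
    · obtain ⟨W, hW, hWi, h0⟩ := exists_submodule_finrank_eq_inner_eq_zero b F
        (Finset.Ico (N + i + 1) (N + m)) (i := i + 1) (by rw [Nat.card_Ico]; omega)
      refine ⟨W, hW, hWi, fun w hw hw0 => ?_⟩
      rw [div_le_iff₀ (hnorm w hw0), hε', add_mul]
      have hsum : ∑ k ∈ B, a k * ⟪b k, (w : H)⟫ ^ 2
          ≤ a (N + i) * ∑ k ∈ B, ⟪b k, (w : H)⟫ ^ 2 := by
        rw [Finset.mul_sum]
        refine Finset.sum_le_sum fun k hk => ?_
        by_cases hki : N + i < k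
        · simp [h0 w hw k (Finset.mem_Ico.2 ⟨hki, (Finset.mem_Ico.1 hk).2⟩)]
        · exact mul_le_mul_of_nonneg_right (ha (by omega)) (sq_nonneg _)
      have h1 := abs_le.1 (hq w (hW hw))
      have h2 := abs_le.1 (hrest w (hW hw))
      linarith
  · set E := Submodule.span ℝ {x : H | ∃ i < m, x = g (N + 1 + i)} with hE
    let ψ : H := ∑ k ∈ B, ⟪b k, (φ : H)⟫ • b k
    have hψ : ψ ∈ E := by
      refine Submodule.sum_mem _ fun k hk => Submodule.smul_mem _ _ (Submodule.subset_span ?_)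
      have := Finset.mem_Ico.1 hk
      exact ⟨k - N, by omega, by rw [hb]; congr 1; omega⟩
    have horth : (φ : H) - ψ ∈ Eᗮ := by
      rw [hE, Submodule.mem_orthogonal]
      intro u hu
      induction hu using Submodule.span_induction with
      | mem x hx =>
        obtain ⟨i, hi, rfl⟩ := hx
        have hiB : N + i ∈ B := Finset.mem_Ico.2 ⟨by omega, by omega⟩
        rw [add_right_comm, ← hb, inner_sub_right, b.orthonormal.inner_right_sum _ hiB, sub_self]
      | zero => simp
      | add x y _ _ hx hy => rw [inner_add_left, hx, hy, add_zero]
      | smul c x _ hx => rw [inner_smul_left, hx, mul_zero]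
    refine ⟨ψ, hψ, horth, ?_⟩
    have hsq : ‖(φ : H) - ψ‖ ^ 2 = ‖(φ : H)‖ ^ 2 - ∑ k ∈ B, ⟪b k, (φ : H)⟫ ^ 2 := by
      rw [← real_inner_self_eq_norm_sq, inner_sub_left,
        Submodule.mem_orthogonal _ _ |>.1 horth ψ hψ, sub_zero, inner_sub_right,
        real_inner_self_eq_norm_sq]
      simp [ψ, inner_sum, inner_smul_right, real_inner_comm, sq]
    have h1 : ‖(φ : H) - ψ‖ ≤ δ / γ * ‖(φ : H)‖ := by
      refine le_of_sq_le_sq ?_ (by positivity)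
      rw [hsq, mul_pow]
      exact hF3 φ hφ
    rw [norm_sub_rev, mul_div_assoc, mul_assoc]
    refine h1.trans (le_mul_of_one_le_left (by positivity) ?_)
    rw [Real.one_le_sqrt]
    norm_num
end
end
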